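/- There are no integers c, d₁, …, d₁₀ with c > 0, ∑_{i=1}^{10} dᵢ = 3c, ∑_{i=1}^{10} dᵢ² = c², and d₁ + d₂ ≥ 2c − 3. -/

import Mathlib

theorem no_isotropic_with_large_d1_d2 :
    ¬ ∃ (c : ℤ) (d : Fin 10 → ℤ),
      0 < c ∧ ∑ i, d i = 3 * c ∧ ∑ i, (d i) ^ 2 = c ^ 2 ∧ 2 * c - 3 ≤ d 0 + d 1 := by
  rintro ⟨c, d, hc, h1, h2, h3⟩
  -- integrality: `x ≤ x ^ 2`
  have hi : ∀ x : ℤ, x ≤ x ^ 2 := fun x => Int.le_self_sq x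
  -- Cauchy-Schwarz on the last eight coordinates
  have hcs := sq_sum_le_card_mul_sum_sq (s := (Finset.univ : Finset (Fin 8)))
    (f := fun i => d i.succ.succ)
  have hi8 : ∑ i : Fin 8, d i.succ.succ ≤ ∑ i : Fin 8, (d i.succ.succ) ^ 2 :=
    Finset.sum_le_sum fun i _ => hi _
  rw [Fin.sum_univ_succ, Fin.sum_univ_succ] at h1 h2
  simp only [Finset.card_univ, Fintype.card_fin, Fin.succ_zero_eq_one] at hcs h1 h2
  push_cast at hcs
  generalize ∑ i : Fin 8, d i.succ.succ = S at *
  generalize ∑ i : Fin 8, (d i.succ.succ) ^ 2 = Q at *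
  generalize d 0 = a at *
  generalize d 1 = b at *
  have hS : S = 3 * c - (a + b) := by linarith
  have hQ : Q = c ^ 2 - a ^ 2 - b ^ 2 := by linarith
  subst hS hQ
  have ha := hi a
  have hb := hi b
  have hc3 : 3 ≤ c := by nlinarith
  have hle : a + b ≤ c := by
    by_contra! h
    nlinarith [sq_nonneg (a - b), mul_pos (show 0 < 5 * (a + b) - c by linarith)
      (show 0 < a + b - c by linarith)]
  have hc' : c = 3 := by linarith
  subst hc'
  have hb' : b = 3 - a := by linarith
  subst hb'
  have : a ≤ 1 ∨ 2 ≤ a := by omega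
  rcases this with h | h <;> nlinarith
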